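/- Let G be a finite connected simple graph on n vertices. If the graph G* admits a locating (n+3)-coloring, then G admits a proper 3-coloring. -/

import Mathlib

open SimpleGraph

/-- Distance from `x` to the color class of `c`. -/
noncomputable def distToClass {V : Type*} (G : SimpleGraph V) {k : ℕ} (f : V → Fin k)
    (x : V) (c : Fin k) : ℕ :=
  sInf {n | ∃ y, f y = c ∧ G.dist x y = n}

/-- `f` is a locating `k`-coloring of `G`. -/
def IsLColoring {V : Type*} (G : SimpleGraph V) (k : ℕ) (f : V → Fin k) : Prop :=
  (∀ u v, G.Adj u v → f u ≠ f v) ∧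
  ∀ u v, u ≠ v → f u = f v → ∃ c : Fin k, distToClass G f u c ≠ distToClass G f v c

/-- The vertex set of the graph `G*` built from a graph `G` on `n` vertices:
the original vertices `u_i`, the copies `u'_i`, the gadget centers `x_i`,
the gadget independent sets `A_i` (of size `n-1`) and `B_i` (of size `n+2`),
and the three vertices `y_1, y_2, y_3`. -/
inductive StarV (n : ℕ) : Type
  | orig : Fin n → StarV n
  | copy : Fin n → StarV n
  | gx : Fin n → StarV n
  | ga : Fin n → Fin (n - 1) → StarV n
  | gb : Fin n → Fin (n + 2) → StarV n
  | gy : Fin 3 → StarV n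
  deriving DecidableEq, Fintype

/-- The base relation generating the edges of `G*`. -/
def starRel {n : ℕ} (G : SimpleGraph (Fin n)) : StarV n → StarV n → Prop
  | .orig i, .orig j => G.Adj i j
  | .copy i, .copy j => G.Adj i j
  | .orig i, .copy j => G.Adj i j
  | .gx i, .ga i' _ => i = i'
  | .gx i, .gb i' _ => i = i'
  | .orig i, .ga i' _ => i = i'
  | .copy i, .ga i' _ => i = i'
  | .gy _, .ga _ _ => True
  | .gy _, .gx _ => True
  | _, _ => False

/-- The graph `G*` constructed from `G`. -/
def GStar {n : ℕ} (G : SimpleGraph (Fin n)) : SimpleGraph (StarV n) :=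
  SimpleGraph.fromRel (starRel G)

theorem dist_twin {V : Type*} (G : SimpleGraph V) {a b y : V} (hab : ∀ z, G.Adj a z ↔ G.Adj b z)
    (ha : a ≠ y) (hb : b ≠ y) : G.dist a y = G.dist b y := by
  rw [SimpleGraph.dist_eq_sInf, SimpleGraph.dist_eq_sInf]
  congr 1
  ext m
  constructor
  · rintro ⟨p, rfl⟩
    cases p with
    | nil => exact absurd rfl ha
    | cons h p => exact ⟨Walk.cons ((hab _).1 h) p, by simp⟩
  · rintro ⟨p, rfl⟩
    cases p with
    | nil => exact absurd rfl hb
    | cons h p => exact ⟨Walk.cons ((hab _).2 h) p, by simp⟩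

theorem dtc_self {V : Type*} (G : SimpleGraph V) {k : ℕ} (f : V → Fin k) (x : V) :
    distToClass G f x (f x) = 0 := by
  unfold distToClass
  exact Nat.sInf_eq_zero.2 (Or.inl ⟨x, rfl, by simp⟩)

theorem twin_ne {V : Type*} (G : SimpleGraph V) {k : ℕ} {f : V → Fin k} (hf : IsLColoring G k f)
    {a b : V} (hne : a ≠ b) (hab : ∀ z, G.Adj a z ↔ G.Adj b z) : f a ≠ f b := by
  intro he
  obtain ⟨c, hc⟩ := hf.2 a b hne he
  apply hc
  by_cases h : c = f a
  · subst h
    rw [dtc_self, he, dtc_self]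
  · unfold distToClass
    congr 1
    ext m
    constructor
    · rintro ⟨y, rfl, rfl⟩
      exact ⟨y, rfl, (dist_twin G hab (by rintro rfl; exact h rfl)
        (by rintro rfl; exact h he.symm)).symm⟩
    · rintro ⟨y, rfl, rfl⟩
      exact ⟨y, rfl, (dist_twin G hab (by rintro rfl; exact h rfl)
        (by rintro rfl; exact h he.symm))⟩

theorem star_key {n : ℕ} (G : SimpleGraph (Fin n))
    {f : StarV n → Fin (n + 3)} (hf : IsLColoring (GStar G) (n + 3) f) (i : Fin n) (c : Fin (n+3)) :
    (∃ j, f (.gy j) = c) ∨ f (.gx i) = c ∨ ∃ j, f (.ga i j) = c := by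
  let φ : Fin 3 ⊕ Unit ⊕ Fin (n - 1) → Fin (n + 3) :=
    Sum.elim (fun j => f (.gy j)) (Sum.elim (fun _ => f (.gx i)) (fun j => f (.ga i j)))
  have hy : Function.Injective (fun j => f (.gy j)) := by
    intro j k h
    by_contra hne
    refine twin_ne _ hf (a := .gy j) (b := .gy k) (by simpa using hne) ?_ h
    intro z
    cases z <;> simp [GStar, starRel]
  have ha : Function.Injective (fun j => f (.ga i j)) := by
    intro j k h
    by_contra hne
    refine twin_ne _ hf (a := .ga i j) (b := .ga i k) (by simpa using hne) ?_ h
    intro z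
    cases z <;> simp [GStar, starRel]
  have hinj : Function.Injective φ := by
    refine Function.Injective.sumElim hy (Function.Injective.sumElim (fun _ _ _ => rfl) ha ?_) ?_
    · intro _ j
      exact hf.1 _ _ (by simp [GStar, starRel])
    · rintro j (k | k)
      · exact hf.1 _ _ (by simp [GStar, starRel])
      · exact hf.1 _ _ (by simp [GStar, starRel])
  have hb : Function.Bijective φ := by
    rw [Fintype.bijective_iff_injective_and_card]
    refine ⟨hinj, ?_⟩
    have := i.pos
    simp
    omega
  obtain ⟨z, hz⟩ := hb.2 c
  rcases z with j | j | j
  · exact Or.inl ⟨j, hz⟩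
  · exact Or.inr (Or.inl hz)
  · exact Or.inr (Or.inr ⟨j, hz⟩)

/-- If `G*` admits a locating `(n+3)`-coloring, where `G` is a connected graph on `n`
vertices, then `G` admits a proper 3-coloring. -/
theorem stmt13 {n : ℕ} (G : SimpleGraph (Fin n)) (hconn : G.Connected)
    (h : ∃ f : StarV n → Fin (n + 3), IsLColoring (GStar G) (n + 3) f) :
    G.Colorable 3 := by
  obtain ⟨f, hf⟩ := h
  have key : ∀ i, ∃ j, f (.gy j) = f (.orig i) ∨ f (.gy j) = f (.copy i) := by
    intro i
    have hne : f (.orig i) ≠ f (.copy i) := by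
      refine twin_ne _ hf (by simp) ?_
      intro z
      cases z <;> simp [GStar, starRel, G.adj_comm]
      all_goals
        intro h
        try rintro rfl
        simp_all
    rcases star_key G hf i (f (.orig i)) with ⟨j, h⟩ | h1 | ⟨j, h⟩
    · exact ⟨j, Or.inl h⟩
    · rcases star_key G hf i (f (.copy i)) with ⟨j, h⟩ | h2 | ⟨j, h⟩
      · exact ⟨j, Or.inr h⟩
      · exact absurd (h1.symm.trans h2) hne
      · exact absurd h (hf.1 _ _ (by simp [GStar, starRel]))
    · exact absurd h (hf.1 _ _ (by simp [GStar, starRel]))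
  choose g hg using key
  refine ⟨Coloring.mk g ?_⟩
  intro u v huv he
  have h1 := hg u
  have h2 := hg v
  rw [← he] at h2
  have hn : u ≠ v := huv.ne
  have e1 := hf.1 (.orig u) (.orig v) (by simp [GStar, starRel, huv, hn])
  have e2 := hf.1 (.orig u) (.copy v) (by simp [GStar, starRel, huv])
  have e3 := hf.1 (.copy u) (.orig v) (by simp [GStar, starRel, huv.symm])
  have e4 := hf.1 (.copy u) (.copy v) (by simp [GStar, starRel, huv, hn])
  rcases h1 with h1 | h1 <;> rcases h2 with h2 | h2 <;> rw [h1] at h2 <;> contradiction
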